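/- Let Q = (W,≼,S,ℓ) be a deterministic quasimodel, and let ⟦·⟧^ℓ be the valuation on the dynamic poset (W,≼,S) determined by ⟦p⟧^ℓ = {w ∈ W : p ∈ ℓ⁺(w)} and the recursive semantic clauses. Then for every □-free formula φ and every w ∈ W: (1) if φ ∈ ℓ⁺(w) then w ∈ ⟦φ⟧^ℓ, and (2) if φ ∈ ℓ⁻(w) then w ∉ ⟦φ⟧^ℓ. -/

import Mathlib

/-- Formulas of the □-free language `L◇`. -/
inductive FormulaD : Type
  | bot : FormulaD
  | var : ℕ → FormulaD
  | and : FormulaD → FormulaD → FormulaD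
  | or : FormulaD → FormulaD → FormulaD
  | impl : FormulaD → FormulaD → FormulaD
  | next : FormulaD → FormulaD
  | diam : FormulaD → FormulaD
deriving DecidableEq

/-- A pair of finite sets of formulas (the candidate negative and positive parts
of a two-sided type). -/
structure PreType : Type where
  neg : Finset FormulaD
  pos : Finset FormulaD

/-- `Φ = (Φ⁻; Φ⁺)` is a two-sided type. -/
def IsType (Φ : PreType) : Prop :=
  (∀ φ ∈ Φ.neg, φ ∉ Φ.pos) ∧
  FormulaD.bot ∉ Φ.pos ∧
  (∀ φ ψ : FormulaD, .and φ ψ ∈ Φ.pos → φ ∈ Φ.pos ∧ ψ ∈ Φ.pos) ∧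
  (∀ φ ψ : FormulaD, .and φ ψ ∈ Φ.neg → φ ∈ Φ.neg ∨ ψ ∈ Φ.neg) ∧
  (∀ φ ψ : FormulaD, .or φ ψ ∈ Φ.pos → φ ∈ Φ.pos ∨ ψ ∈ Φ.pos) ∧
  (∀ φ ψ : FormulaD, .or φ ψ ∈ Φ.neg → φ ∈ Φ.neg ∧ ψ ∈ Φ.neg) ∧
  (∀ φ ψ : FormulaD, .impl φ ψ ∈ Φ.pos → φ ∈ Φ.neg ∨ ψ ∈ Φ.pos) ∧
  (∀ φ : FormulaD, .diam φ ∈ Φ.neg → φ ∈ Φ.neg)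

/-- The order `Φ ≼ Ψ` on types: `Ψ⁻ ⊆ Φ⁻` and `Φ⁺ ⊆ Ψ⁺`. -/
def TLe (Φ Ψ : PreType) : Prop := Ψ.neg ⊆ Φ.neg ∧ Φ.pos ⊆ Ψ.pos

/-- The order `Φ ⊑ Ψ` on types: `Φ⁻ = Ψ⁻` and `Φ⁺ ⊆ Ψ⁺`. -/
def TSqle (Φ Ψ : PreType) : Prop := Φ.neg = Ψ.neg ∧ Φ.pos ⊆ Ψ.pos

/-- The temporal relation `Φ S_T Ψ` on types. -/
def TS (Φ Ψ : PreType) : Prop :=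
  (∀ φ : FormulaD, .next φ ∈ Φ.pos → φ ∈ Ψ.pos) ∧
  (∀ φ : FormulaD, .next φ ∈ Φ.neg → φ ∈ Ψ.neg) ∧
  (∀ φ : FormulaD, .diam φ ∈ Φ.pos → φ ∈ Φ.pos ∨ FormulaD.diam φ ∈ Ψ.pos) ∧
  (∀ φ : FormulaD, .diam φ ∈ Φ.neg → FormulaD.diam φ ∈ Ψ.neg)

/-- The up-set topology of a preorder: the open sets are the upward closed sets. -/
def upsetTopology (X : Type) [Preorder X] : TopologicalSpace X where
  IsOpen U := IsUpperSet U
  isOpen_univ := isUpperSet_univ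
  isOpen_inter := fun _ _ hU hV => hU.inter hV
  isOpen_sUnion := fun _ hs => isUpperSet_sUnion hs

/-- The valuation `⟦·⟧^ℓ` on the dynamic poset `(W, ≼, S)` determined by a
labelling `ℓ`, with `⟦p⟧^ℓ = {w : p ∈ ℓ⁺(w)}` and the recursive semantic
clauses (implication is interpreted via the interior operator of the up-set
topology). -/
def labelVal (W : Type) [PartialOrder W] (S : W → W) (ℓ : W → PreType) :
    FormulaD → Set W
  | .bot => ∅
  | .var n => {w : W | FormulaD.var n ∈ (ℓ w).pos}
  | .and φ ψ => labelVal W S ℓ φ ∩ labelVal W S ℓ ψ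
  | .or φ ψ => labelVal W S ℓ φ ∪ labelVal W S ℓ ψ
  | .impl φ ψ =>
      @interior W (upsetTopology W) ((labelVal W S ℓ φ)ᶜ ∪ labelVal W S ℓ ψ)
  | .next φ => S ⁻¹' labelVal W S ℓ φ
  | .diam φ => ⋃ n : ℕ, (S^[n]) ⁻¹' labelVal W S ℓ φ

/-- A point is interior to `A` in the up-set topology iff its whole up-set lies in `A`. -/
theorem mem_interior_upsetTopology {X : Type} [Preorder X] {A : Set X} {x : X} :
    x ∈ @interior X (upsetTopology X) A ↔ ∀ y, x ≤ y → y ∈ A := by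
  letI := upsetTopology X
  rw [mem_interior]
  constructor
  · rintro ⟨U, hUA, hU, hx⟩ y hxy
    have hU' : IsUpperSet U := hU
    exact hUA (hU' hxy hx)
  · intro h
    exact ⟨Set.Ici x, h, isUpperSet_Ici x, le_rfl⟩

/-- Along a sensible function, a negative `◇φ` persists to every iterate. -/
theorem diam_mem_neg_iterate {W : Type} {S : W → W} {ℓ : W → PreType}
    (hsens : ∀ w : W, TS (ℓ w) (ℓ (S w))) {φ : FormulaD} {w : W}
    (h : .diam φ ∈ (ℓ w).neg) (n : ℕ) : .diam φ ∈ (ℓ (S^[n] w)).neg := by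
  induction n with
  | zero => exact h
  | succ n ih =>
    rw [Function.iterate_succ_apply']
    exact (hsens _).2.2.2 φ ih

/-- Lemma 4 (truth lemma): in a deterministic quasimodel `(W, ≼, S, ℓ)`,
every formula in `ℓ⁺(w)` is satisfied at `w` and every formula in `ℓ⁻(w)` is
falsified at `w` with respect to the valuation `⟦·⟧^ℓ`. -/
theorem truth_lemma (W : Type) [PartialOrder W] (S : W → W) (ℓ : W → PreType)
    -- `ℓ` assigns two-sided types
    (htype : ∀ w, IsType (ℓ w))
    -- `(W, ≼, ℓ)` is a labelled frame
    (hmono : ∀ w v : W, w ≤ v → TLe (ℓ w) (ℓ v))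
    (hwit : ∀ (w : W) (φ ψ : FormulaD), .impl φ ψ ∈ (ℓ w).neg →
      ∃ v : W, w ≤ v ∧ φ ∈ (ℓ v).pos ∧ ψ ∈ (ℓ v).neg)
    -- `S` is a forward-confluent (i.e. monotone) function
    (hS : Monotone S)
    -- `S` is sensible
    (hsens : ∀ w : W, TS (ℓ w) (ℓ (S w)))
    -- `S` is ω-sensible
    (homega : ∀ (w : W) (φ : FormulaD), .diam φ ∈ (ℓ w).pos →
      ∃ n : ℕ, φ ∈ (ℓ (S^[n] w)).pos) :
    ∀ (φ : FormulaD) (w : W),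
      (φ ∈ (ℓ w).pos → w ∈ labelVal W S ℓ φ) ∧
      (φ ∈ (ℓ w).neg → w ∉ labelVal W S ℓ φ) := by
  intro φ
  induction φ with
  | bot => exact fun w => ⟨fun h => absurd h (htype w).2.1, fun _ => Set.notMem_empty w⟩
  | var n => exact fun w => ⟨id, (htype w).1 _⟩
  | and φ ψ ihφ ihψ =>
    intro w
    obtain ⟨-, -, hpos, hneg, -⟩ := htype w
    refine ⟨fun h => ⟨(ihφ w).1 (hpos _ _ h).1, (ihψ w).1 (hpos _ _ h).2⟩, fun h hw => ?_⟩
    rcases hneg _ _ h with h | h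
    · exact (ihφ w).2 h hw.1
    · exact (ihψ w).2 h hw.2
  | or φ ψ ihφ ihψ =>
    intro w
    obtain ⟨-, -, -, -, hpos, hneg, -⟩ := htype w
    refine ⟨fun h => (hpos _ _ h).imp (ihφ w).1 (ihψ w).1, fun h hw => ?_⟩
    rcases hw with hw | hw
    · exact (ihφ w).2 (hneg _ _ h).1 hw
    · exact (ihψ w).2 (hneg _ _ h).2 hw
  | impl φ ψ ihφ ihψ =>
    intro w
    rw [labelVal, mem_interior_upsetTopology]
    refine ⟨fun h v hwv => ?_, fun h hw => ?_⟩
    · obtain ⟨-, -, -, -, -, -, hpos, -⟩ := htype v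
      exact (hpos _ _ ((hmono w v hwv).2 h)).imp (ihφ v).2 (ihψ v).1
    · obtain ⟨v, hwv, hφ, hψ⟩ := hwit w φ ψ h
      rcases hw v hwv with hv | hv
      · exact hv ((ihφ v).1 hφ)
      · exact (ihψ v).2 hψ hv
  | next φ ih =>
    exact fun w => ⟨fun h => (ih _).1 ((hsens w).1 φ h), fun h => (ih _).2 ((hsens w).2.1 φ h)⟩
  | diam φ ih =>
    intro w
    rw [labelVal, Set.mem_iUnion]
    refine ⟨fun h => ?_, ?_⟩
    · obtain ⟨n, hn⟩ := homega w φ h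
      exact ⟨n, (ih _).1 hn⟩
    · rintro h ⟨n, hn⟩
      obtain ⟨-, -, -, -, -, -, -, hneg⟩ := htype (S^[n] w)
      exact (ih _).2 (hneg φ (diam_mem_neg_iterate hsens h n)) hn
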